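/- arXiv:1505.01806 — 3 statements merged into one kernel-verified Lean document; each statement's English description precedes it below -/
import Mathlib

section
/- Let Y := { r·exp(2πik/3·i) : r ∈ ℝ, r ≥ 0, k ∈ {0,1,2} } ⊆ ℂ be the standard tripod, and let T := { z ∈ ℂ : Re z = 0 } ∪ { z ∈ ℂ : Im z = 0 and Re z ≥ 0 } ⊆ ℂ be the T-shaped set consisting of the imaginary axis together with the non-negative real axis. Then there exists a homeomorphism h : ℂ → ℂ with h(T) = Y. -/
open Complex

/-- The standard tripod: the union of the three closed rays from the origin at
angles `0`, `2π/3` and `4π/3`. -/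
def tripod : Set ℂ :=
  {z : ℂ | ∃ (r : ℝ) (k : Fin 3), 0 ≤ r ∧
    z = (r : ℂ) * Complex.exp (2 * Real.pi * (k : ℕ) / 3 * Complex.I)}

/-- The T-shaped set: the imaginary axis together with the non-negative real axis. -/
def tee : Set ℂ := {z : ℂ | z.re = 0} ∪ {z : ℂ | z.im = 0 ∧ 0 ≤ z.re}

/-- The shear of the plane used to bend the imaginary axis. -/
noncomputable def teeShear (c : ℝ) : ℂ ≃ₜ ℂ where
  toFun z := ⟨z.re - c * |z.im|, z.im⟩
  invFun z := ⟨z.re + c * |z.im|, z.im⟩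
  left_inv z := by apply Complex.ext <;> simp
  right_inv z := by apply Complex.ext <;> simp
  continuous_toFun := by
    have : Continuous fun z : ℂ => Complex.equivRealProdCLM.symm (z.re - c * |z.im|, z.im) := by
      fun_prop
    exact this
  continuous_invFun := by
    have : Continuous fun z : ℂ => Complex.equivRealProdCLM.symm (z.re + c * |z.im|, z.im) := by
      fun_prop
    exact this

theorem tripod_exp_one :
    Complex.exp (2 * Real.pi * ((1 : ℕ) : ℂ) / 3 * Complex.I) = ⟨-(1/2), √3 / 2⟩ := by
  have h : (2 * Real.pi * ((1 : ℕ) : ℂ) / 3 * Complex.I)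
      = ((Real.pi - Real.pi / 3 : ℝ) : ℂ) * Complex.I := by push_cast; ring
  rw [h]
  apply Complex.ext
  · rw [Complex.exp_ofReal_mul_I_re, Real.cos_pi_sub, Real.cos_pi_div_three]
  · rw [Complex.exp_ofReal_mul_I_im, Real.sin_pi_sub, Real.sin_pi_div_three]

theorem tripod_exp_two :
    Complex.exp (2 * Real.pi * ((2 : ℕ) : ℂ) / 3 * Complex.I) = ⟨-(1/2), -(√3 / 2)⟩ := by
  have h : (2 * Real.pi * ((2 : ℕ) : ℂ) / 3 * Complex.I)
      = ((Real.pi / 3 + Real.pi : ℝ) : ℂ) * Complex.I := by push_cast; ring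
  rw [h]
  apply Complex.ext
  · rw [Complex.exp_ofReal_mul_I_re, Real.cos_add_pi, Real.cos_pi_div_three]
  · rw [Complex.exp_ofReal_mul_I_im, Real.sin_add_pi, Real.sin_pi_div_three]

theorem mem_tripod_iff (z : ℂ) : z ∈ tripod ↔
    (∃ r : ℝ, 0 ≤ r ∧ z.re = r ∧ z.im = 0) ∨
    (∃ r : ℝ, 0 ≤ r ∧ z.re = -(r / 2) ∧ z.im = r * (√3 / 2)) ∨
    (∃ r : ℝ, 0 ≤ r ∧ z.re = -(r / 2) ∧ z.im = -(r * (√3 / 2))) := by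
  have e0 : ∀ r : ℝ, z = (r : ℂ) * Complex.exp (2 * Real.pi * ((0 : ℕ) : ℂ) / 3 * Complex.I) ↔
      z.re = r ∧ z.im = 0 := by
    intro r; simp [Complex.ext_iff]
  have e1 : ∀ r : ℝ, z = (r : ℂ) * Complex.exp (2 * Real.pi * ((1 : ℕ) : ℂ) / 3 * Complex.I) ↔
      z.re = -(r / 2) ∧ z.im = r * (√3 / 2) := by
    intro r; rw [tripod_exp_one, Complex.ext_iff]; simp [div_eq_mul_inv]
  have e2 : ∀ r : ℝ, z = (r : ℂ) * Complex.exp (2 * Real.pi * ((2 : ℕ) : ℂ) / 3 * Complex.I) ↔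
      z.re = -(r / 2) ∧ z.im = -(r * (√3 / 2)) := by
    intro r; rw [tripod_exp_two, Complex.ext_iff]; simp [div_eq_mul_inv]
  constructor
  · rintro ⟨r, k, hr, h⟩
    fin_cases k
    · exact Or.inl ⟨r, hr, (e0 r).1 h⟩
    · exact Or.inr (Or.inl ⟨r, hr, (e1 r).1 h⟩)
    · exact Or.inr (Or.inr ⟨r, hr, (e2 r).1 h⟩)
  · rintro (⟨r, hr, h⟩ | ⟨r, hr, h⟩ | ⟨r, hr, h⟩)
    · exact ⟨r, 0, hr, (e0 r).2 h⟩
    · exact ⟨r, 1, hr, (e1 r).2 h⟩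
    · exact ⟨r, 2, hr, (e2 r).2 h⟩

/-- There is a self-homeomorphism of `ℂ` carrying the T-shaped set onto the tripod. -/
theorem exists_homeomorph_tee_eq_tripod :
    ∃ h : ℂ ≃ₜ ℂ, h '' tee = tripod := by
  refine ⟨teeShear (√3 / 3), ?_⟩
  have h3 : √3 * √3 = 3 := Real.mul_self_sqrt (by norm_num)
  have hp : 0 < √3 := Real.sqrt_pos.2 (by norm_num)
  ext w
  rw [← Homeomorph.coe_toEquiv, Equiv.image_eq_preimage_symm, Set.mem_preimage, mem_tripod_iff]
  change ((w.re + √3 / 3 * |w.im| = 0) ∨ (w.im = 0 ∧ 0 ≤ w.re + √3 / 3 * |w.im|)) ↔ _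
  constructor
  · rintro (h | ⟨h, h'⟩)
    · right
      rcases le_total 0 w.im with hi | hi
      · left
        rw [abs_of_nonneg hi] at h
        exact ⟨2 * (√3 / 3 * w.im), by positivity, by linarith, by linear_combination (-w.im / 3) * h3⟩
      · right
        rw [abs_of_nonpos hi] at h
        have : 0 ≤ -w.im := by linarith
        exact ⟨2 * (√3 / 3 * -w.im), by positivity, by linarith,
          by linear_combination (-w.im / 3) * h3⟩
    · left
      rw [h] at h'
      exact ⟨w.re, by simpa using h', rfl, h⟩
  · rintro (⟨r, hr, h, h'⟩ | ⟨r, hr, h, h'⟩ | ⟨r, hr, h, h'⟩)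
    · right
      rw [h, h']
      simpa using hr
    · left
      rw [h, h', abs_of_nonneg (by positivity)]
      linear_combination (r / 6) * h3
    · left
      rw [h, h', abs_neg, abs_of_nonneg (by positivity)]
      linear_combination (r / 6) * h3
end

section
/- Let Y := { r·exp(2πik/3·i) : r ∈ ℝ, r ≥ 0, k ∈ {0,1,2} } ⊆ ℂ be the standard tripod, and endow ℝ × Y ⊆ ℝ × ℂ with the subspace topology. Then no point of ℝ × {0} ⊆ ℝ × Y has an open neighbourhood in ℝ × Y that is homeomorphic to an open subset of ℝ². -/
open Complex

/-- The local model `ℝ × Y ⊆ ℝ × ℂ` of a tribranched surface along its branching set. -/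
def tripodModel : Set (ℝ × ℂ) := {p : ℝ × ℂ | p.2 ∈ tripod}

theorem aux_const {A : Type*} [TopologicalSpace A] [PreconnectedSpace A] (d : A → ℂ)
    (hd : Continuous d) (h : ∀ a b, Complex.exp (d a) = Complex.exp (d b)) (a b : A) :
    d a = d b := by
  have := Complex.isCoveringMap_exp.eq_of_comp_eq (g₁ := d) (g₂ := fun _ => d b) hd
    continuous_const (by
      funext x
      exact Subtype.ext (h x b)) b rfl
  exact congrFun this a

theorem aux_lift {A : Type*} [TopologicalSpace A] [SimplyConnectedSpace A]
    [LocallyPathConnectedSpace A] (a₀ : A) (G : A → ℂ) (hG : Continuous G) (h0 : ∀ a, G a ≠ 0) :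
    ∃ g : A → ℂ, Continuous g ∧ ∀ a, Complex.exp (g a) = G a := by
  obtain ⟨F, ⟨-, hF⟩, -⟩ := Complex.isCoveringMapOn_exp.existsUnique_continuousMap_lifts
    (⟨G, hG⟩ : C(A, ℂ)) (a₀ := a₀) (e₀ := Complex.log (G a₀)) (Complex.exp_log (h0 a₀))
    (fun a => h0 a)
  exact ⟨F, F.continuous, fun a => congrFun hF a⟩

theorem aux_E_period (θ : ℝ) : Complex.exp (((θ + 2 * Real.pi : ℝ) : ℂ) * Complex.I)
    = Complex.exp ((θ : ℂ) * Complex.I) := by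
  rw [Complex.exp_eq_exp_iff_exists_int]
  exact ⟨1, by push_cast; ring⟩

theorem aux_E_anti (θ : ℝ) : Complex.exp (((θ + Real.pi : ℝ) : ℂ) * Complex.I)
    = - Complex.exp ((θ : ℂ) * Complex.I) := by
  push_cast
  rw [add_mul, Complex.exp_add, Complex.exp_pi_mul_I]; ring

theorem aux_invdom (f : ℂ → ℂ) (hf : Continuous f) (hi : Function.Injective f) :
    Set.range f ∈ nhds (f 0) := by
  set E : ℝ → ℂ := fun θ => Complex.exp ((θ : ℂ) * Complex.I) with hE
  have hEc : Continuous E := by fun_prop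
  have hE0 : ∀ θ, E θ ≠ 0 := fun θ => Complex.exp_ne_zero _
  have hEn : ∀ θ, ‖E θ‖ = 1 := fun θ => Complex.norm_exp_ofReal_mul_I θ
  have hEp : ∀ θ, E (θ + 2 * Real.pi) = E θ := aux_E_period
  have hEa : ∀ θ, E (θ + Real.pi) = - E θ := aux_E_anti
  -- lower bound on the circle
  obtain ⟨m, hm, hmin⟩ : ∃ m : ℝ, 0 < m ∧ ∀ θ, m ≤ ‖f (E θ) - f 0‖ := by
    obtain ⟨z, hz, hzm⟩ := (isCompact_sphere (0 : ℂ) 1).exists_isMinOn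
      (f := fun z => ‖f z - f 0‖) ⟨1, by simp⟩ (by fun_prop)
    refine ⟨‖f z - f 0‖, ?_, fun θ => hzm (by simp [hEn])⟩
    rw [norm_pos_iff, sub_ne_zero]
    intro h
    have := hi h
    simp [this] at hz
  refine Filter.mem_of_superset (Metric.ball_mem_nhds (f 0) hm) ?_
  intro c hc
  by_contra hcr
  have hcr' : ∀ z, f z - c ≠ 0 := fun z h => hcr ⟨z, sub_eq_zero.1 h⟩
  rw [Metric.mem_ball, dist_eq_norm] at hc
  -- first lift
  obtain ⟨g, hgc, hg⟩ := aux_lift (A := ℝ × ℝ) (0, 0)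
    (fun q => f (E q.1) - f (-((|q.2| : ℝ) : ℂ) * E q.1)) (by fun_prop) (by
      rintro ⟨θ, t⟩ h
      have h1 := hi (sub_eq_zero.1 h)
      have h2 : (1 + ((|t| : ℝ) : ℂ)) * E θ = 0 := by linear_combination h1
      rcases mul_eq_zero.1 h2 with h3 | h3
      · have : (1 + |t| : ℝ) = 0 := by exact_mod_cast h3
        have := abs_nonneg t
        linarith
      · exact hE0 θ h3)
  -- second lift
  obtain ⟨l, hlc, hl⟩ := aux_lift (A := ℝ × ℝ) (0, 0)
    (fun q => f ((q.2 : ℂ) * E q.1) - c) (by fun_prop) (fun q => hcr' _)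
  have hgper := aux_const (fun q : ℝ × ℝ => g (q.1 + 2 * Real.pi, q.2) - g q) (by fun_prop) (by
    have : ∀ q : ℝ × ℝ, Complex.exp (g (q.1 + 2 * Real.pi, q.2) - g q) = 1 := by
      intro q
      rw [Complex.exp_sub, div_eq_one_iff_eq (Complex.exp_ne_zero _), hg, hg]
      simp only [hEp]
    intro a b
    simp only [this])
  have hlper := aux_const (fun q : ℝ × ℝ => l (q.1 + 2 * Real.pi, q.2) - l q) (by fun_prop) (by
    have : ∀ q : ℝ × ℝ, Complex.exp (l (q.1 + 2 * Real.pi, q.2) - l q) = 1 := by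
      intro q
      rw [Complex.exp_sub, div_eq_one_iff_eq (Complex.exp_ne_zero _), hl, hl]
      simp only [hEp]
    intro a b
    simp only [this])
  have hl0 := aux_const (fun θ : ℝ => l (θ, 0)) (by fun_prop) (by
    intro a b
    simp [hl])
  -- l is periodic
  have hl1 : l (2 * Real.pi, 1) = l (0, 1) := by
    have h1 := hlper (0, 1) (0, 0)
    have h2 := hl0 (2 * Real.pi) 0
    simp only [zero_add] at h1 h2
    rw [h2] at h1
    linear_combination h1
  -- antiperiodicity
  have hex : ∀ θ : ℝ, Complex.exp (g (θ + Real.pi, 1) - g (θ, 1)) = -1 := by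
    intro θ
    rw [Complex.exp_sub, div_eq_iff (Complex.exp_ne_zero _), hg, hg]
    simp only [hEa]
    simp
  have hganti := aux_const (fun θ : ℝ => g (θ + Real.pi, 1) - g (θ, 1)) (by fun_prop) (by
    intro a b
    simp only [hex])
  have hg1 : g (2 * Real.pi, 1) - g (0, 1) ≠ 0 := by
    intro h
    have h1 := hganti Real.pi 0
    have h2 := hex 0
    simp only [zero_add] at h1 h2
    rw [← two_mul] at h1
    have h3 : g (Real.pi, 1) - g (0, 1) = 0 := by linear_combination (h - h1) / 2
    rw [h3, Complex.exp_zero] at h2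
    norm_num at h2
  have hg2 : g (2 * Real.pi, 0) - g (0, 0) ≠ 0 := by
    have h1 := hgper (0, 1) (0, 0)
    simp only [zero_add] at h1
    rwa [← h1]
  -- comparison
  have hne : ∀ θ, f (E θ) - f 0 ≠ 0 := fun θ h => by
    have := hmin θ
    rw [h, norm_zero] at this
    linarith
  have hsl : ∀ θ, (f (E θ) - c) / (f (E θ) - f 0) ∈ Complex.slitPlane := by
    intro θ
    have h1 : (f (E θ) - c) / (f (E θ) - f 0) = 1 + (f 0 - c) / (f (E θ) - f 0) := by
      field_simp [hne θ]
      ring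
    rw [h1]
    apply Complex.mem_slitPlane_of_norm_lt_one
    rw [norm_div, div_lt_one (norm_pos_iff.2 (hne θ)), norm_sub_rev]
    exact lt_of_lt_of_le hc (hmin θ)
  have hcmp := aux_const (fun θ : ℝ => l (θ, 1) - g (θ, 0)
      - Complex.log ((f (E θ) - c) / (f (E θ) - f 0)))
    ((by fun_prop : Continuous fun θ : ℝ => l (θ, 1) - g (θ, 0)).sub
      (Continuous.clog (Continuous.div (by fun_prop) (by fun_prop) hne) hsl)) (by
    have : ∀ θ : ℝ, Complex.exp (l (θ, 1) - g (θ, 0)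
        - Complex.log ((f (E θ) - c) / (f (E θ) - f 0))) = 1 := by
      intro θ
      rw [Complex.exp_sub, Complex.exp_sub, Complex.exp_log (div_ne_zero (hcr' _) (hne θ)), hl, hg]
      simp only [abs_zero, Complex.ofReal_zero, neg_zero, zero_mul, Complex.ofReal_one, one_mul]
      exact div_self (div_ne_zero (hcr' _) (hne θ))
    intro a b
    simp only [this])
  have h1 := hcmp (2 * Real.pi) 0
  have h2 := hEp 0
  rw [zero_add] at h2
  simp only [h2, hl1] at h1
  exact hg2 (by linear_combination -h1)

theorem aux_ray (r : ℝ) (hr : 0 ≤ r) (k : Fin 3) :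
    (r : ℂ) * Complex.exp (((2 * Real.pi * (k : ℕ) / 3 : ℝ) : ℂ) * Complex.I) ∈ tripod :=
  ⟨r, k, hr, by push_cast; rfl⟩

/-- No point of the axis `ℝ × {0}` of the model `ℝ × Y` (with the subspace topology from
`ℝ × ℂ`) has an open neighbourhood in `ℝ × Y` homeomorphic to an open subset of `ℝ²`. -/
theorem tripodModel_axis_not_surface_point (p : tripodModel) (hp : p.val.2 = 0) :
    ¬ ∃ (U : Set tripodModel) (V : Set (ℝ × ℝ)), IsOpen U ∧ IsOpen V ∧
      p ∈ U ∧ Nonempty (U ≃ₜ V) := by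
  rintro ⟨U, V, hU, -, hpU, ⟨e⟩⟩
  obtain ⟨w, hw, hwt⟩ : ∃ w : ℂ, 0 < w.im ∧ ∀ r : ℝ, 0 ≤ r → (r : ℂ) * w ∈ tripod := by
    refine ⟨_, ?_, fun r hr => aux_ray r hr 1⟩
    rw [Complex.exp_ofReal_mul_I_im]
    apply Real.sin_pos_of_pos_of_lt_pi
    · simp; positivity
    · simp; linarith [Real.pi_pos]
  obtain ⟨v, hv, hvt⟩ : ∃ v : ℂ, v.im < 0 ∧ ∀ r : ℝ, 0 ≤ r → (r : ℂ) * v ∈ tripod := by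
    refine ⟨_, ?_, fun r hr => aux_ray r hr 2⟩
    rw [Complex.exp_ofReal_mul_I_im]
    have h : 2 * Real.pi * ((2 : Fin 3) : ℕ) / 3 = Real.pi / 3 + Real.pi := by
      simp; ring
    rw [h, Real.sin_add_pi, neg_lt_zero]
    apply Real.sin_pos_of_pos_of_lt_pi <;> linarith [Real.pi_pos]
  have hot : ∀ r : ℝ, 0 ≤ r → (r : ℂ) ∈ tripod := by
    intro r hr
    have := aux_ray r hr 0
    simpa using this
  -- pages one and two
  let φ : ℂ → tripodModel := fun z =>
    ⟨(p.val.1 + z.re, ((max z.im 0 : ℝ) : ℂ) + ((max (-z.im) 0 : ℝ) : ℂ) * w), by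
      change _ ∈ tripod
      rcases le_total 0 z.im with h | h
      · have h1 : max (-z.im) 0 = 0 := max_eq_right (by linarith)
        simp only [h1, Complex.ofReal_zero, zero_mul, add_zero]
        exact hot _ (le_max_right _ _)
      · have h1 : max (z.im) 0 = 0 := max_eq_right (by linarith)
        simp only [h1, Complex.ofReal_zero, zero_add]
        exact hwt _ (le_max_right _ _)⟩
  have hφc : Continuous φ := by
    apply Continuous.subtype_mk
    fun_prop
  have hφim : ∀ z, (φ z).val.2.im = max (-z.im) 0 * w.im := by
    intro z
    simp [φ]
  have hφre : ∀ z, (φ z).val.2.re = max z.im 0 + max (-z.im) 0 * w.re := by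
    intro z
    simp [φ]
  have hφi : Function.Injective φ := by
    intro z z' h
    have h1 : (φ z).val.1 = (φ z').val.1 := by rw [h]
    have h2 : (φ z).val.2.im = (φ z').val.2.im := by rw [h]
    have h3 : (φ z).val.2.re = (φ z').val.2.re := by rw [h]
    rw [hφim, hφim] at h2
    have h4 := mul_right_cancel₀ hw.ne' h2
    rw [hφre, hφre, h4] at h3
    have h5 := add_right_cancel h3
    apply Complex.ext
    · exact add_left_cancel h1
    · have e1 := max_zero_sub_eq_self z.im
      have e2 := max_zero_sub_eq_self z'.im
      rw [max_comm] at h4 h5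
      simp only [max_comm] at *
      linarith
  have hφ0 : φ 0 = p := by
    apply Subtype.ext
    apply Prod.ext
    · simp [φ]
    · simp [φ, hp]
  -- page three
  let χ : ℝ → tripodModel := fun s => ⟨(p.val.1, ((max s 0 : ℝ) : ℂ) * v),
    hvt _ (le_max_right _ _)⟩
  have hχc : Continuous χ := by
    apply Continuous.subtype_mk
    fun_prop
  have hχ0 : χ 0 = p := by
    apply Subtype.ext
    apply Prod.ext
    · simp [χ]
    · simp [χ, hp]
  obtain ⟨ε, hε, hball⟩ := Metric.isOpen_iff.1 (hU.preimage hφc) 0 (by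
    change φ 0 ∈ U
    rwa [hφ0])
  let b := OpenPartialHomeomorph.univBall (0 : ℂ) ε
  have hbU : ∀ z, φ (b z) ∈ U := fun z => hball (by
    rw [← OpenPartialHomeomorph.univBall_target (0 : ℂ) hε]
    exact b.map_source (by simp [b]))
  have hbi : Function.Injective b := by
    intro x y h
    exact b.injOn (by simp [b]) (by simp [b]) h
  have hbc : Continuous b := OpenPartialHomeomorph.continuous_univBall _ _
  let j : U → ℂ := fun u => Complex.equivRealProdCLM.symm (e u).val
  have hjc : Continuous j :=
    Complex.equivRealProdCLM.symm.continuous.comp (continuous_subtype_val.comp e.continuous)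
  have hji : Function.Injective j :=
    Complex.equivRealProdCLM.symm.injective.comp (Subtype.val_injective.comp e.injective)
  let ψ : ℂ → U := fun z => ⟨φ (b z), hbU z⟩
  have hψc : Continuous ψ := (hφc.comp hbc).subtype_mk _
  have hψi : Function.Injective ψ := by
    intro x y h
    exact hbi (hφi (congrArg Subtype.val h))
  have hψ0 : ψ 0 = ⟨p, hpU⟩ := by
    apply Subtype.ext
    change φ (b 0) = p
    rw [show b 0 = 0 from OpenPartialHomeomorph.univBall_apply_zero _ _, hφ0]
  have key := aux_invdom (j ∘ ψ) (hjc.comp hψc) (hji.comp hψi)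
  have k1 : j ⁻¹' (Set.range (j ∘ ψ)) ∈ nhds (⟨p, hpU⟩ : U) := by
    apply hjc.continuousAt
    rw [← hψ0]
    exact key
  have k2 := hU.isOpenEmbedding_subtypeVal.image_mem_nhds.2 k1
  have k3 : χ ⁻¹' (Subtype.val '' (j ⁻¹' (Set.range (j ∘ ψ)))) ∈ nhds (0 : ℝ) := by
    apply hχc.continuousAt
    rw [hχ0]
    exact k2
  obtain ⟨δ, hδ, hδb⟩ := Metric.mem_nhds_iff.1 k3
  obtain ⟨u, ⟨z, hz⟩, hu⟩ := hδb (show δ / 2 ∈ Metric.ball (0 : ℝ) δ by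
    rw [Metric.mem_ball, Real.dist_eq, sub_zero, abs_of_pos (by linarith)]
    linarith)
  have h1 : ψ z = u := hji hz
  have h2 : φ (b z) = χ (δ / 2) := by
    rw [← hu, ← h1]
  have h3 : (φ (b z)).val.2.im = (χ (δ / 2)).val.2.im := by rw [h2]
  rw [hφim] at h3
  have h4 : (χ (δ / 2)).val.2.im = δ / 2 * v.im := by
    have : max (δ / 2) 0 = δ / 2 := max_eq_left (by linarith)
    simp only [χ, this, Complex.re_ofReal_mul, Complex.im_ofReal_mul]
  rw [h4] at h3
  have h5 : 0 ≤ max (-(b z).im) 0 * w.im := mul_nonneg (le_max_right _ _) hw.le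
  have h6 : δ / 2 * v.im < 0 := mul_neg_of_pos_of_neg (by linarith) hv
  linarith
end

section
/- Let Y := { r·exp(2πik/3·i) : r ∈ ℝ, r ≥ 0, k ∈ {0,1,2} } ⊆ ℂ be the standard tripod. Let M be a topological space and Σ ⊆ M a closed subset with the following property: for every x ∈ Σ there exist an open set U ⊆ M with x ∈ U, an open set V ⊆ ℝ × ℂ, and a homeomorphism φ : U → V (of subspaces) such that φ(Σ ∩ U) = Λ ∩ V, where Λ is either the plane ℝ × { z ∈ ℂ : Im z = 0 } or the model ℝ × Y. Let C ⊆ Σ be the set of points x ∈ Σ admitting no such triple (U, V, φ) with Λ the plane ℝ × { z ∈ ℂ : Im z = 0 }. Then every point of C has an open neighbourhood in C (with the subspace topology) homeomorphic to an open subset of ℝ. -/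
open Complex

/-- The plane model `ℝ × {z : ℂ | Im z = 0} ⊆ ℝ × ℂ`. -/
def planeModel : Set (ℝ × ℂ) := {p : ℝ × ℂ | p.2.im = 0}

/-- `S` is modelled on `Λ ⊆ ℝ × ℂ` at the point `x`: there are an open neighbourhood
`U` of `x`, an open set `V ⊆ ℝ × ℂ` and a homeomorphism `φ : U → V` of subspaces with
`φ (S ∩ U) = Λ ∩ V`. -/
def ModelledAt {M : Type*} [TopologicalSpace M] (S : Set M) (Λ : Set (ℝ × ℂ)) (x : M) :
    Prop :=
  ∃ (U : Set M) (V : Set (ℝ × ℂ)), IsOpen U ∧ IsOpen V ∧ x ∈ U ∧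
    ∃ φ : U ≃ₜ V, φ '' {p : U | (p : M) ∈ S} = {q : V | (q : ℝ × ℂ) ∈ Λ}

theorem modelledAt_iff {M : Type*} [TopologicalSpace M] (S : Set M) (Λ : Set (ℝ × ℂ)) (x : M) :
    ModelledAt S Λ x ↔ ∃ f : OpenPartialHomeomorph M (ℝ × ℂ), x ∈ f.source ∧
      ∀ y ∈ f.source, (y ∈ S ↔ f y ∈ Λ) := by
  constructor
  · rintro ⟨U, V, hU, hV, hx, φ, hφ⟩
    have : Nonempty U := ⟨⟨x, hx⟩⟩
    have : Nonempty V := ⟨φ ⟨x, hx⟩⟩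
    let a := (⟨U, hU⟩ : TopologicalSpace.Opens M).openPartialHomeomorphSubtypeCoe ‹_›
    let b := (⟨V, hV⟩ : TopologicalSpace.Opens (ℝ × ℂ)).openPartialHomeomorphSubtypeCoe ‹_›
    have ha : ∀ u : U, a.symm (u : M) = u := fun u => a.left_inv (x := u) (by simp [a])
    refine ⟨a.symm.trans (φ.toOpenPartialHomeomorph.trans b), ?_, ?_⟩
    · simp [a, b, hx]
    · intro y hy
      have hyU : y ∈ U := by simpa [a, b] using hy
      have h1 : (a.symm.trans (φ.toOpenPartialHomeomorph.trans b)) y = (φ ⟨y, hyU⟩ : ℝ × ℂ) := by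
        have := ha ⟨y, hyU⟩
        simp only [OpenPartialHomeomorph.coe_trans, Function.comp_apply]
        rw [this]
        rfl
      rw [h1]
      have h2 := Set.ext_iff.1 hφ (φ ⟨y, hyU⟩)
      rw [φ.injective.mem_set_image] at h2
      exact h2
  · rintro ⟨f, hx, hf⟩
    refine ⟨f.source, f.target, f.open_source, f.open_target, hx, f.toHomeomorphSourceTarget, ?_⟩
    ext q
    constructor
    · rintro ⟨p, hp, rfl⟩
      exact (hf p p.2).1 hp
    · intro hq
      refine ⟨f.toHomeomorphSourceTarget.symm q, ?_, by simp⟩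
      have h := f.map_target q.2
      refine (hf _ h).2 ?_
      have : f (f.symm q) = q := f.right_inv q.2
      rw [this]; exact hq

theorem tripod_rot (z : ℂ) (hz : z ∈ tripod) (hz0 : z ≠ 0) :
    ∃ c : ℂ, c ≠ 0 ∧ 0 < (c * z).re ∧ ∀ w : ℂ, 0 < (c * w).re → (w ∈ tripod ↔ (c * w).im = 0) := by
  obtain ⟨r, k, hr, rfl⟩ := hz
  have hr0 : 0 < r := lt_of_le_of_ne hr (by rintro rfl; simp at hz0)
  set E : ℂ := Complex.exp (2 * Real.pi * (k : ℕ) / 3 * Complex.I) with hE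
  have hE0 : E ≠ 0 := Complex.exp_ne_zero _
  refine ⟨E⁻¹, inv_ne_zero hE0, ?_, ?_⟩
  · have : E⁻¹ * (r * E) = r := by field_simp
    rw [this]; simpa using hr0
  · intro w hw
    constructor
    · rintro ⟨s, j, hs, rfl⟩
      have key : E⁻¹ * (s * Complex.exp (2 * Real.pi * (j : ℕ) / 3 * Complex.I)) =
          s * Complex.exp ((2 * Real.pi * ((j : ℕ) - (k : ℕ) : ℝ) / 3 : ℝ) * Complex.I) := by
        rw [hE, ← Complex.exp_neg, mul_left_comm, ← Complex.exp_add]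
        congr 2
        push_cast
        ring
      rw [key] at hw ⊢
      rw [Complex.re_ofReal_mul, Complex.exp_ofReal_mul_I_re] at hw
      rw [Complex.im_ofReal_mul, Complex.exp_ofReal_mul_I_im]
      have c1 : Real.cos (2 * Real.pi / 3) = -(1/2) := by
        rw [show 2 * Real.pi / 3 = Real.pi - Real.pi / 3 by ring, Real.cos_pi_sub,
          Real.cos_pi_div_three]
      have c2 : Real.cos (2 * Real.pi * 2 / 3) = -(1/2) := by
        rw [show 2 * Real.pi * 2 / 3 = Real.pi / 3 + Real.pi by ring, Real.cos_add_pi,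
          Real.cos_pi_div_three]
      have d : ((j : ℕ) - (k : ℕ) : ℝ) = 0 ∨
          Real.cos (2 * Real.pi * ((j : ℕ) - (k : ℕ) : ℝ) / 3) = -(1/2) := by
        have c1' : Real.cos (2 * Real.pi * (-1) / 3) = -(1/2) := by
          rw [← c1, ← Real.cos_neg]; congr 1; ring
        have c2' : Real.cos (2 * Real.pi * (-2) / 3) = -(1/2) := by
          rw [← c2, ← Real.cos_neg]; congr 1; ring
        clear key hw hE
        norm_num at c1 c2 c1' c2'
        fin_cases j <;> fin_cases k <;> norm_num <;> assumption
      rcases d with d | d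
      · rw [d]; simp
      · rw [d] at hw; nlinarith
    · intro h
      refine ⟨(E⁻¹ * w).re, k, hw.le, ?_⟩
      rw [← hE]
      have : (((E⁻¹ * w).re : ℝ) : ℂ) = E⁻¹ * w := by
        apply Complex.ext <;> simp [h] 
      rw [this]; field_simp

theorem zero_mem_tripod : (0 : ℂ) ∈ tripod := ⟨0, 0, le_refl _, by simp⟩

/-- The branching set of a pre-tribranched surface is a 1-dimensional manifold: every
point of the set `C` of points of `S` admitting no plane chart has an open neighbourhood
in `C` homeomorphic to an open subset of `ℝ`. -/
theorem branchingSet_is_one_manifold {M : Type*} [TopologicalSpace M]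
    (S : Set M) (hS : IsClosed S)
    (hmod : ∀ x ∈ S, ModelledAt S planeModel x ∨ ModelledAt S tripodModel x)
    (C : Set M) (hC : C = {x ∈ S | ¬ ModelledAt S planeModel x}) :
    ∀ x : C, ∃ (U : Set C) (V : Set ℝ), IsOpen U ∧ IsOpen V ∧ x ∈ U ∧
      Nonempty (U ≃ₜ V) := by
  rintro ⟨x, hxC⟩
  have hx := hxC
  rw [hC] at hx
  obtain ⟨hxS, hxn⟩ := hx
  obtain ⟨f, hxf, hf⟩ := (modelledAt_iff _ _ _).1 ((hmod x hxS).resolve_left hxn)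
  -- points of the branching set lie on the axis
  have axis : ∀ y ∈ f.source, y ∈ S → ¬ ModelledAt S planeModel y → (f y).2 = 0 := by
    intro y hy hyS hn
    by_contra h0
    apply hn
    obtain ⟨c, hc, hcy, hcw⟩ := tripod_rot _ ((hf y hy).1 hyS) h0
    let e : (ℝ × ℂ) ≃ₜ (ℝ × ℂ) := (Homeomorph.refl ℝ).prodCongr (Homeomorph.mulLeft₀ c hc)
    have he : ∀ p, e p = (p.1, c * p.2) := fun p => rfl
    have hW : IsOpen {p : ℝ × ℂ | 0 < p.2.re} :=
      isOpen_lt continuous_const (Complex.continuous_re.comp continuous_snd)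
    refine (modelledAt_iff _ _ _).2
      ⟨(f.trans e.toOpenPartialHomeomorph).trans
        (OpenPartialHomeomorph.ofSet _ hW), ?_, ?_⟩
    · simpa [he, hy] using hcy
    · intro z hz
      simp [he] at hz
      simp only [OpenPartialHomeomorph.coe_trans, Function.comp_apply,
        OpenPartialHomeomorph.ofSet_apply, id, Homeomorph.toOpenPartialHomeomorph_apply, he]
      rw [hf z hz.1]
      exact hcw _ (by simpa using hz.2)
  have hx0 := axis x hxf hxS hxn
  have conv : ∀ y ∈ f.source, (y ∈ C ↔ (f y).2 = 0) := by
    intro y hy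
    rw [hC]
    constructor
    · rintro ⟨h1, h2⟩; exact axis y hy h1 h2
    · intro h0
      refine ⟨(hf y hy).2 (by simp only [tripodModel, Set.mem_setOf_eq, h0]; exact zero_mem_tripod), ?_⟩
      intro hp
      apply hxn
      obtain ⟨g, hyg, hg⟩ := (modelledAt_iff _ _ _).1 hp
      let e : (ℝ × ℂ) ≃ₜ (ℝ × ℂ) := Homeomorph.addRight (f y - f x)
      have he : ∀ p, e p = p + (f y - f x) := fun p => rfl
      have hxy : e (f x) = f y := by rw [he, add_sub_cancel]
      refine (modelledAt_iff _ _ _).2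
        ⟨((f.trans e.toOpenPartialHomeomorph).trans f.symm).trans g, ?_, ?_⟩
      · simp [hxf, hxy, hy, hyg]
      · intro z hz
        simp at hz
        obtain ⟨⟨hz1, hz2⟩, hz3⟩ := hz
        simp only [OpenPartialHomeomorph.coe_trans, Function.comp_apply,
          Homeomorph.toOpenPartialHomeomorph_apply]
        rw [← hg _ hz3, hf z hz1, hf _ (f.map_target hz2), f.right_inv hz2]
        simp [tripodModel, he, h0, hx0]
  have hj : Continuous (fun t : ℝ => ((t, 0) : ℝ × ℂ)) := by fun_prop
  refine ⟨{c : C | (c : M) ∈ f.source}, {t : ℝ | ((t, 0) : ℝ × ℂ) ∈ f.target},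
    f.open_source.preimage continuous_subtype_val, f.open_target.preimage hj, hxf, ⟨?_⟩⟩
  have hpt : ∀ c : {c : C | (c : M) ∈ f.source}, (((f c.1.1).1, 0) : ℝ × ℂ) = f c.1.1 := by
    intro c
    exact Prod.ext rfl ((conv _ c.2).1 c.1.2).symm
  exact
  { toFun := fun c => ⟨(f c.1.1).1, by
      show (((f c.1.1).1, 0) : ℝ × ℂ) ∈ f.target
      rw [hpt]; exact f.map_source c.2⟩
    invFun := fun t => ⟨⟨f.symm (t.1, 0), by
      rw [conv _ (f.map_target t.2), f.right_inv t.2]⟩, f.map_target t.2⟩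
    left_inv := by
      intro c
      apply Subtype.ext
      apply Subtype.ext
      show f.symm ((f c.1.1).1, 0) = c.1.1
      rw [hpt, f.left_inv c.2]
    right_inv := by
      intro t
      apply Subtype.ext
      show (f (f.symm (t.1, 0))).1 = t.1
      rw [f.right_inv t.2]
    continuous_toFun := by
      refine Continuous.subtype_mk ?_ _
      refine continuous_fst.comp ?_
      exact f.continuousOn.comp_continuous
        (continuous_subtype_val.comp continuous_subtype_val) (fun c => c.2)
    continuous_invFun := by
      refine Continuous.subtype_mk (Continuous.subtype_mk ?_ _) _
      exact f.symm.continuousOn.comp_continuous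
        (hj.comp continuous_subtype_val) (fun t => t.2) }
end
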